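/- Let α ∈ [0, π/2), let A, B ∈ M_n(ℂ) be sector matrices of angle α, and let 1 ≤ k ≤ n. Then ∏_{j=1}^{k} s_j((A+B)^{-1}) ≤ (sec^{4k}(α)/4^k) · ∏_{j=1}^{k} s_j(I_n + A^{-1}) · ∏_{j=1}^{k} s_j(I_n + B^{-1}). -/

import Mathlib

open Matrix
open scoped ComplexOrder

/-- The real (Hermitian) part of a complex matrix: `Re A = (A + Aᴴ)/2`. -/
noncomputable def matRe {n : ℕ} (A : Matrix (Fin n) (Fin n) ℂ) : Matrix (Fin n) (Fin n) ℂ :=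
  (2⁻¹ : ℂ) • (A + Aᴴ)

/-- `A` is a sector matrix of angle `α`: its numerical range is contained in
`S_α = {z : Re z > 0, |Im z| ≤ tan α · Re z}`. -/
def InSector {n : ℕ} (α : ℝ) (A : Matrix (Fin n) (Fin n) ℂ) : Prop :=
  ∀ x : Fin n → ℂ, star x ⬝ᵥ x = 1 →
    0 < (star x ⬝ᵥ A *ᵥ x).re ∧
      |(star x ⬝ᵥ A *ᵥ x).im| ≤ Real.tan α * (star x ⬝ᵥ A *ᵥ x).re

/-- The `j`-th largest singular value of `X` (eigenvalues of `(XᴴX)^{1/2}` in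
decreasing order): `sval X 0 ≥ sval X 1 ≥ …`. -/
noncomputable def sval {n : ℕ} (X : Matrix (Fin n) (Fin n) ℂ) (j : Fin n) : ℝ :=
  Real.sqrt ((Matrix.posSemidef_conjTranspose_mul_self X).1.eigenvalues
    (Tuple.sort (Matrix.posSemidef_conjTranspose_mul_self X).1.eigenvalues j.rev))


section
variable {m p : Type*} [Fintype m] [DecidableEq m] [Fintype p] [DecidableEq p]

lemma aux_one_le_det {Q : Matrix m m ℂ} (hQ : Q.PosSemidef) : 1 ≤ ‖(1 + Q).det‖ := by
  have h : (1 + Q).det = ∏ i, (1 + (hQ.1.eigenvalues i : ℂ)) := by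
    conv_lhs => rw [hQ.1.spectral_theorem, Unitary.conjStarAlgAut_apply, mul_assoc,
      det_one_add_mul_comm, mul_assoc, Unitary.coe_star_mul_self, mul_one]
    rw [← diagonal_one, diagonal_add, det_diagonal]
    rfl
  rw [h, norm_prod]
  refine Finset.prod_induction _ (fun x : ℝ => 1 ≤ x) (fun a b => one_le_mul_of_one_le_of_one_le) le_rfl ?_
  intro i _
  have h0 := hQ.eigenvalues_nonneg i
  have : (1 + (hQ.1.eigenvalues i : ℂ)) = ((1 + hQ.1.eigenvalues i : ℝ) : ℂ) := by push_cast; rfl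
  rw [this, Complex.norm_real, Real.norm_eq_abs, abs_of_nonneg (by linarith)]
  linarith

open scoped MatrixOrder in
lemma aux_factor {X : Matrix m m ℂ} (hX : X.PosSemidef) : ∃ N : Matrix m m ℂ, X = Nᴴ * N :=
  CStarAlgebra.nonneg_iff_eq_star_mul_self.mp hX.nonneg

lemma aux_det_mono {X Y : Matrix m m ℂ} (hX : X.PosSemidef) (hXY : (Y - X).PosSemidef) :
    ‖X.det‖ ≤ ‖Y.det‖ := by
  by_cases h0 : X.det = 0
  · simp [h0]
  obtain ⟨N, rfl⟩ := aux_factor hX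
  have hN : IsUnit N.det := by
    rw [det_mul] at h0
    exact isUnit_iff_ne_zero.mpr (right_ne_zero_of_mul h0)
  have e1 : N⁻¹ * N = 1 := nonsing_inv_mul _ hN
  have e2 : Nᴴ * (N⁻¹)ᴴ = 1 := by rw [← conjTranspose_mul, e1, conjTranspose_one]
  have hq := aux_one_le_det (hXY.conjTranspose_mul_mul_same N⁻¹)
  have : Y = Nᴴ * (1 + (N⁻¹)ᴴ * (Y - Nᴴ * N) * N⁻¹) * N := by
    have : Nᴴ * (1 + (N⁻¹)ᴴ * (Y - Nᴴ * N) * N⁻¹) * N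
      = Nᴴ * N + (Nᴴ * (N⁻¹)ᴴ) * (Y - Nᴴ * N) * (N⁻¹ * N) := by noncomm_ring
    rw [this, e1, e2]; simp
  rw [this, det_mul, det_mul, det_mul, norm_mul, norm_mul, norm_mul]
  nlinarith [mul_nonneg (norm_nonneg Nᴴ.det) (norm_nonneg N.det)]

lemma aux_OT {H K : Matrix m m ℂ} (hH : H.PosDef) (hK : K.IsHermitian) :
    ‖H.det‖ ≤ ‖(H + Complex.I • K).det‖ := by
  obtain ⟨N, rfl⟩ := aux_factor hH.posSemidef
  have hN : IsUnit N.det := by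
    have := hH.det_pos.ne'
    rw [det_mul] at this
    exact isUnit_iff_ne_zero.mpr (right_ne_zero_of_mul this)
  have e1 : N⁻¹ * N = 1 := nonsing_inv_mul _ hN
  have e2 : Nᴴ * (N⁻¹)ᴴ = 1 := by rw [← conjTranspose_mul, e1, conjTranspose_one]
  set L := (N⁻¹)ᴴ * K * N⁻¹ with hL
  have hLH : Lᴴ = L := by
    rw [hL, conjTranspose_mul, conjTranspose_mul, conjTranspose_conjTranspose, hK.eq, mul_assoc]
  have hz : 1 ≤ ‖(1 + Complex.I • L).det‖ := by
    have h1 := aux_one_le_det (posSemidef_conjTranspose_mul_self L)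
    have h2 : 1 + Lᴴ * L = (1 + Complex.I • L)ᴴ * (1 + Complex.I • L) := by
      rw [conjTranspose_add, conjTranspose_smul, conjTranspose_one, hLH]
      simp [add_mul, mul_add, smul_smul]
    rw [h2, det_mul, det_conjTranspose, norm_mul, norm_star] at h1
    nlinarith [norm_nonneg (1 + Complex.I • L).det]
  have : Nᴴ * N + Complex.I • K = Nᴴ * (1 + Complex.I • L) * N := by
    have : Nᴴ * (1 + Complex.I • L) * N
      = Nᴴ * N + Complex.I • ((Nᴴ * (N⁻¹)ᴴ) * K * (N⁻¹ * N)) := by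
      rw [hL]; simp only [mul_add, add_mul, mul_smul_comm, smul_mul_assoc, mul_one, mul_assoc]
    rw [this, e1, e2]; simp
  rw [this, det_mul, det_mul, det_mul, norm_mul, norm_mul, norm_mul]
  nlinarith [mul_nonneg (norm_nonneg Nᴴ.det) (norm_nonneg N.det)]

lemma aux_frame_compl {V : Matrix m p ℂ} (hV : Vᴴ * V = 1) : (1 - V * Vᴴ).PosSemidef := by
  have h := posSemidef_conjTranspose_mul_self (1 - V * Vᴴ)
  have e : (1 - V * Vᴴ)ᴴ * (1 - V * Vᴴ) = 1 - V * Vᴴ := by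
    have : (1 - V * Vᴴ) * (1 - V * Vᴴ) = 1 - V * Vᴴ - V * Vᴴ + V * (Vᴴ * V) * Vᴴ := by
      simp only [sub_mul, mul_sub, one_mul, mul_one, Matrix.mul_assoc]; abel
    simp [this, hV]
  rwa [e] at h

lemma aux_frame_det {V : Matrix m p ℂ} (hV : Vᴴ * V = 1) (D : Matrix m m ℂ) :
    ‖(Vᴴ * D * V).det‖ ^ 2 ≤ ‖(Vᴴ * (Dᴴ * D) * V).det‖ := by
  have h := aux_det_mono (posSemidef_conjTranspose_mul_self (Vᴴ * D * V))
    (Y := Vᴴ * (Dᴴ * D) * V) (by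
      have := (aux_frame_compl hV).conjTranspose_mul_mul_same (D * V)
      convert this using 1
      simp only [conjTranspose_mul, conjTranspose_conjTranspose, Matrix.mul_sub, Matrix.sub_mul,
        Matrix.mul_assoc, Matrix.one_mul, Matrix.mul_one])
  rw [det_mul, det_conjTranspose, norm_mul, norm_star, ← sq] at h
  exact h

lemma aux_det_sq {H : Matrix m m ℂ} (hH : H.PosSemidef) :
    4 ^ Fintype.card m * ‖H.det‖ ≤ ‖(1 + H).det‖ ^ 2 := by
  have h := aux_det_mono (X := (4 : ℂ) • H) (Y := (1 + H) * (1 + H))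
    (hH.smul (by norm_num)) (by
      have := posSemidef_conjTranspose_mul_self (1 - H)
      convert this using 1
      rw [conjTranspose_sub, hH.1.eq, conjTranspose_one]
      simp only [add_mul, mul_add, sub_mul, mul_sub, one_mul, mul_one]
      module)
  rw [det_smul, det_mul, norm_mul, norm_mul, ← sq, norm_pow] at h
  simpa using h

lemma aux_main_det {P Q : Matrix m m ℂ} (hP : P.PosSemidef) (hQ : Q.PosSemidef) :
    4 ^ Fintype.card m * (‖P.det‖ * ‖Q.det‖) ≤
      ‖(P + Q).det‖ * (‖(1 + P).det‖ * ‖(1 + Q).det‖) := by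
  have h1 := aux_det_sq hP
  have h2 := aux_det_sq hQ
  have h3 : ‖P.det‖ ≤ ‖(P + Q).det‖ := aux_det_mono hP (by simpa using hQ)
  have h4 : ‖Q.det‖ ≤ ‖(P + Q).det‖ := aux_det_mono hQ (by simpa using hP)
  apply le_of_sq_le_sq _ (by positivity)
  calc (4 ^ Fintype.card m * (‖P.det‖ * ‖Q.det‖)) ^ 2
      = (‖P.det‖ * ‖Q.det‖) * ((4 ^ Fintype.card m * ‖P.det‖) * (4 ^ Fintype.card m * ‖Q.det‖)) := by
        ring
    _ ≤ (‖(P + Q).det‖ * ‖(P + Q).det‖) * (‖(1 + P).det‖ ^ 2 * ‖(1 + Q).det‖ ^ 2) := by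
        gcongr
    _ = _ := by ring
end

lemma aux_kyfan {n k : ℕ} (hk1 : 1 ≤ k) (hkn : k ≤ n) (d : Fin n → ℝ) (hd : ∀ i, 0 < d i)
    (e : Equiv.Perm (Fin n)) (he : Antitone (d ∘ e)) {V : Matrix (Fin n) (Fin k) ℂ}
    (hV : Vᴴ * V = 1) :
    ‖(Vᴴ * diagonal (fun i => (d i : ℂ)) * V).det‖ ≤ ∏ j : Fin k, d (e (Fin.castLE hkn j)) := by
  set i0 : Fin n := ⟨k - 1, by omega⟩ with hi0
  set μ := d (e i0) with hμ
  have hμ0 : 0 < μ := hd _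
  set g : Fin n → ℝ := fun i => max (d i / μ - 1) 0 with hg
  have hg0 : ∀ i, 0 ≤ g i := fun i => le_max_right _ _
  set G : Matrix (Fin n) (Fin n) ℂ := diagonal (fun i => ((Real.sqrt (g i) : ℝ) : ℂ)) with hG
  have hGG : G * G = diagonal (fun i => (g i : ℂ)) := by
    rw [hG, diagonal_mul_diagonal]
    congr 1; ext i
    rw [← Complex.ofReal_mul, Real.mul_self_sqrt (hg0 i)]
  have hGH : Gᴴ = G := by
    rw [hG, diagonal_conjTranspose]
    congr 1; ext i; simp
  have hD : (diagonal (fun i => (d i : ℂ)) : Matrix (Fin n) (Fin n) ℂ).PosSemidef := by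
    apply PosSemidef.diagonal
    intro i; simpa using (hd i).le
  have h1 : ‖(Vᴴ * diagonal (fun i => (d i : ℂ)) * V).det‖ ≤
      ‖((μ : ℂ) • (1 + (Vᴴ * G) * (G * V))).det‖ := by
    apply aux_det_mono (hD.conjTranspose_mul_mul_same V)
    have h2 : ((μ : ℂ) • (1 + G * G) - diagonal (fun i => (d i : ℂ))).PosSemidef := by
      rw [hGG, ← diagonal_one, diagonal_add, ← diagonal_smul, diagonal_sub]
      apply PosSemidef.diagonal
      intro i
      have : 0 ≤ μ * (1 + g i) - d i := by
        have : d i / μ - 1 ≤ g i := le_max_left _ _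
        have h3 : d i = μ * (d i / μ) := by field_simp
        nlinarith
      simpa using (by exact_mod_cast this : (0 : ℂ) ≤ (μ * (1 + g i) - d i : ℂ))
    convert h2.conjTranspose_mul_mul_same V using 1
    simp only [Matrix.mul_sub, Matrix.sub_mul, Matrix.mul_add, Matrix.add_mul, smul_add,
      Matrix.mul_smul, Matrix.smul_mul, Matrix.mul_one, hV, Matrix.mul_assoc]
  have h2 : ‖(1 + (G * V) * (Vᴴ * G)).det‖ ≤ ‖(1 + G * G).det‖ := by
    apply aux_det_mono
    · apply PosSemidef.one.add
      have := posSemidef_self_mul_conjTranspose (G * V)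
      rwa [conjTranspose_mul, hGH] at this
    · convert (aux_frame_compl hV).conjTranspose_mul_mul_same G using 1
      rw [hGH]
      simp only [Matrix.mul_sub, Matrix.sub_mul, Matrix.mul_one, Matrix.mul_assoc]
      abel
  have h3 : ‖(1 + G * G).det‖ = ∏ i, (1 + g i) := by
    rw [hGG, ← diagonal_one, diagonal_add, det_diagonal, norm_prod]
    congr 1; ext i
    have : (1 + (g i : ℂ)) = ((1 + g i : ℝ) : ℂ) := by push_cast; rfl
    rw [this, Complex.norm_real, Real.norm_eq_abs, abs_of_nonneg (by linarith [hg0 i])]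
  have h4 : ∏ i, (1 + g i) = ∏ j : Fin k, (d (e (Fin.castLE hkn j)) / μ) := by
    rw [← Equiv.prod_comp e]
    symm
    change ∏ j : Fin k, (fun i => d (e i) / μ) (Fin.castLEEmb hkn j) = _
    rw [← Finset.prod_map Finset.univ (Fin.castLEEmb hkn) (fun i => d (e i) / μ)]
    rw [← Finset.prod_subset (Finset.subset_univ (Finset.univ.map (Fin.castLEEmb hkn)))]
    · apply Finset.prod_congr rfl
      intro i hi
      simp only [Finset.mem_map, Finset.mem_univ, true_and] at hi
      obtain ⟨j, rfl⟩ := hi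
      have : μ ≤ d (e (Fin.castLEEmb hkn j)) := by
        apply he
        rw [Fin.le_def]
        simp [hi0]; omega
      have : 1 ≤ d (e (Fin.castLEEmb hkn j)) / μ := by rwa [one_le_div hμ0]
      simp only [hg]
      rw [max_eq_left (by linarith)]; ring
    · intro i _ hi
      have hik : k ≤ (i : ℕ) := by
        by_contra hlt
        apply hi
        simp only [Finset.mem_map, Finset.mem_univ, true_and]
        exact ⟨⟨i, by omega⟩, by ext; simp⟩
      have : d (e i) ≤ μ := by
        apply he
        rw [Fin.le_def]
        simp [hi0]; omega
      have : d (e i) / μ ≤ 1 := by rwa [div_le_one hμ0]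
      simp only [hg]
      rw [max_eq_right (by linarith)]; ring
  rw [det_smul, norm_mul, det_one_add_mul_comm] at h1
  refine h1.trans ?_
  calc _ ≤ μ ^ k * ∏ j : Fin k, (d (e (Fin.castLE hkn j)) / μ) := by
        rw [← h4, ← h3]
        simp only [norm_pow, Complex.norm_real, Real.norm_eq_abs, abs_of_pos hμ0, Fintype.card_fin]
        gcongr
    _ = _ := by
        rw [Finset.prod_div_distrib]; simp; field_simp

/-- the permutation sorting eigenvalues decreasingly -/
noncomputable def auxPerm {n : ℕ} (d : Fin n → ℝ) : Equiv.Perm (Fin n) :=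
  Fin.revPerm.trans (Tuple.sort d)

lemma auxPerm_antitone {n : ℕ} (d : Fin n → ℝ) : Antitone (d ∘ auxPerm d) := by
  intro i j hij
  exact Tuple.monotone_sort d (Fin.rev_le_rev.mpr hij)

lemma aux_prod_eq {n k : ℕ} (hkn : k ≤ n) (f : Fin n → ℝ) :
    ∏ j ∈ Finset.univ.filter (fun j : Fin n => (j : ℕ) < k), f j =
      ∏ j : Fin k, f (Fin.castLE hkn j) := by
  symm
  change ∏ j : Fin k, f (Fin.castLEEmb hkn j) = _
  rw [← Finset.prod_map Finset.univ (Fin.castLEEmb hkn) f]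
  congr 1
  ext i
  simp only [Finset.mem_map, Finset.mem_univ, true_and, Finset.mem_filter]
  constructor
  · rintro ⟨j, rfl⟩; simp
  · intro h; exact ⟨⟨i, h⟩, by ext; simp⟩

lemma aux_posDef {n : ℕ} {X : Matrix (Fin n) (Fin n) ℂ} (hX : IsUnit X) : (Xᴴ * X).PosDef := by
  rw [(posSemidef_conjTranspose_mul_self X).posDef_iff_isUnit]
  exact hX.star.mul hX

lemma aux_sval_sq {n : ℕ} (X : Matrix (Fin n) (Fin n) ℂ) (j : Fin n) :
    sval X j ^ 2 = (posSemidef_conjTranspose_mul_self X).1.eigenvalues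
      (auxPerm (posSemidef_conjTranspose_mul_self X).1.eigenvalues j) := by
  rw [sval, Real.sq_sqrt]
  · rfl
  · exact (posSemidef_conjTranspose_mul_self X).eigenvalues_nonneg _

lemma aux_sval_pos {n : ℕ} {X : Matrix (Fin n) (Fin n) ℂ} (hX : IsUnit X) (j : Fin n) :
    0 < sval X j := Real.sqrt_pos.mpr ((aux_posDef hX).eigenvalues_pos _)

lemma aux_spec {n : ℕ} (X : Matrix (Fin n) (Fin n) ℂ) : ∃ U : Matrix (Fin n) (Fin n) ℂ,
    Uᴴ * U = 1 ∧ U * Uᴴ = 1 ∧ Xᴴ * X = U * diagonal (fun i =>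
      ((posSemidef_conjTranspose_mul_self X).1.eigenvalues i : ℂ)) * Uᴴ := by
  have hh := (posSemidef_conjTranspose_mul_self X).1
  refine ⟨hh.eigenvectorUnitary, Unitary.coe_star_mul_self _, Unitary.coe_mul_star_self _, ?_⟩
  have := hh.spectral_theorem
  rw [Unitary.conjStarAlgAut_apply] at this
  exact this

lemma aux_sval_upper {n k : ℕ} (hk1 : 1 ≤ k) (hkn : k ≤ n) {X : Matrix (Fin n) (Fin n) ℂ}
    (hX : IsUnit X) {V : Matrix (Fin n) (Fin k) ℂ} (hV : Vᴴ * V = 1) :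
    ‖(Vᴴ * X * V).det‖ ≤ ∏ j : Fin k, sval X (Fin.castLE hkn j) := by
  apply le_of_sq_le_sq _ (Finset.prod_nonneg fun j _ => (aux_sval_pos hX _).le)
  refine (aux_frame_det hV X).trans ?_
  rw [← Finset.prod_pow]
  simp only [aux_sval_sq]
  obtain ⟨U, h1, h2, h3⟩ := aux_spec X
  have h4 := aux_kyfan hk1 hkn _ (fun i => (aux_posDef hX).eigenvalues_pos i) _
    (auxPerm_antitone _) (V := Uᴴ * V) (by
      rw [conjTranspose_mul, conjTranspose_conjTranspose, Matrix.mul_assoc, ← Matrix.mul_assoc U,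
        h2, Matrix.one_mul, hV])
  refine le_of_eq_of_le ?_ h4
  congr 2
  rw [conjTranspose_mul, conjTranspose_conjTranspose]
  conv_lhs => rw [h3]
  simp only [Matrix.mul_assoc]

lemma aux_sval_frame {n k : ℕ} (hkn : k ≤ n) (X : Matrix (Fin n) (Fin n) ℂ) :
    ∃ V : Matrix (Fin n) (Fin k) ℂ, Vᴴ * V = 1 ∧ Vᴴ * (Xᴴ * X) * V =
      diagonal (fun j : Fin k => ((sval X (Fin.castLE hkn j) : ℝ) : ℂ) ^ 2) := by
  obtain ⟨U, h1, h2, h3⟩ := aux_spec X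
  set d := (posSemidef_conjTranspose_mul_self X).1.eigenvalues with hd
  set f : Fin k → Fin n := fun j => auxPerm d (Fin.castLE hkn j) with hf
  have hfi : Function.Injective f :=
    (auxPerm d).injective.comp (Fin.castLE_injective hkn)
  have key : ∀ M : Matrix (Fin n) (Fin n) ℂ,
      (U.submatrix id f)ᴴ * M * (U.submatrix id f) = (Uᴴ * M * U).submatrix f f := by
    intro M; rfl
  have h5 : Uᴴ * (Xᴴ * X) * U = diagonal (fun i => (d i : ℂ)) := by
    rw [h3]
    calc _ = (Uᴴ * U) * diagonal (fun i => (d i : ℂ)) * (Uᴴ * U) := by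
          simp only [Matrix.mul_assoc]
      _ = _ := by rw [h1]; simp
  refine ⟨U.submatrix id f, ?_, ?_⟩
  · have := key 1
    rw [Matrix.mul_one, Matrix.mul_one, h1] at this
    rw [this, submatrix_one _ hfi]
  · rw [key, h5, submatrix_diagonal _ _ hfi]
    congr 1; ext j
    rw [← Complex.ofReal_pow, aux_sval_sq]
    rfl

/-- Product of top singular values of `X` controlled by a compression of its inverse. -/
lemma aux_sval_inv {n k : ℕ} (hkn : k ≤ n) {S X : Matrix (Fin n) (Fin n) ℂ}
    (hSX : S * X = 1) : ∃ W : Matrix (Fin n) (Fin k) ℂ, Wᴴ * W = 1 ∧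
      ‖(Wᴴ * S * W).det‖ * ∏ j : Fin k, sval X (Fin.castLE hkn j) ≤ 1 := by
  have hX : IsUnit X := by
    rw [isUnit_iff_isUnit_det]; exact isUnit_det_of_left_inverse hSX
  obtain ⟨V, hV, hVX⟩ := aux_sval_frame hkn X
  set s : Fin k → ℝ := fun j => sval X (Fin.castLE hkn j) with hs
  have hs0 : ∀ j, 0 < s j := fun j => aux_sval_pos hX _
  set E : Matrix (Fin k) (Fin k) ℂ := diagonal (fun j => ((s j : ℂ))⁻¹) with hE
  have hEH : Eᴴ = E := by
    rw [hE, diagonal_conjTranspose]; congr 1; ext i; simp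
  have hp : 0 < ∏ j, s j := Finset.prod_pos fun j _ => hs0 j
  have hEd : ‖E.det‖ = (∏ j, s j)⁻¹ := by
    rw [hE, det_diagonal, norm_prod, ← Finset.prod_inv_distrib]
    congr 1; ext j
    rw [norm_inv, Complex.norm_real, Real.norm_eq_abs, abs_of_pos (hs0 j)]
  refine ⟨X * V * E, ?_, ?_⟩
  · calc (X * V * E)ᴴ * (X * V * E) = E * (Vᴴ * (Xᴴ * X) * V) * E := by
          simp only [conjTranspose_mul, hEH, Matrix.mul_assoc]
      _ = 1 := by
          rw [hVX, hE, diagonal_mul_diagonal, diagonal_mul_diagonal, ← diagonal_one]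
          congr 1; ext j
          have : (s j : ℂ) ≠ 0 := by exact_mod_cast (hs0 j).ne'
          change (s j : ℂ)⁻¹ * (s j : ℂ) ^ 2 * (s j : ℂ)⁻¹ = 1
          field_simp
  · have h1 : (X * V * E)ᴴ * S * (X * V * E) = E * (Vᴴ * X * V)ᴴ * E := by
      calc _ = E * (Vᴴ * Xᴴ * (S * X) * V) * E := by
            simp only [conjTranspose_mul, hEH, Matrix.mul_assoc]
        _ = _ := by
            rw [hSX]
            simp only [conjTranspose_mul, conjTranspose_conjTranspose, Matrix.mul_assoc,
              Matrix.one_mul]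
    have h2 : ‖(Vᴴ * X * V).det‖ ≤ ∏ j, s j := by
      apply le_of_sq_le_sq _ hp.le
      refine (aux_frame_det hV X).trans ?_
      rw [hVX, det_diagonal, norm_prod, ← Finset.prod_pow]
      apply le_of_eq
      congr 1; ext j
      rw [norm_pow, Complex.norm_real, Real.norm_eq_abs, sq_abs]
    rw [h1, det_mul, det_mul, det_conjTranspose, norm_mul, norm_mul, norm_star, hEd]
    calc _ = ‖(Vᴴ * X * V).det‖ * (∏ j, s j)⁻¹ := by field_simp
      _ ≤ (∏ j, s j) * (∏ j, s j)⁻¹ := by gcongr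
      _ = 1 := mul_inv_cancel₀ hp.ne'

/-- The imaginary (Hermitian) part. -/
noncomputable def auxIm {n : ℕ} (A : Matrix (Fin n) (Fin n) ℂ) : Matrix (Fin n) (Fin n) ℂ :=
  (-Complex.I / 2) • (A - Aᴴ)

lemma matRe_herm {n : ℕ} (A : Matrix (Fin n) (Fin n) ℂ) : (matRe A).IsHermitian := by
  unfold matRe
  rw [IsHermitian, conjTranspose_smul, conjTranspose_add, conjTranspose_conjTranspose, add_comm]
  simp

lemma auxIm_herm {n : ℕ} (A : Matrix (Fin n) (Fin n) ℂ) : (auxIm A).IsHermitian := by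
  unfold auxIm
  rw [IsHermitian, conjTranspose_smul, conjTranspose_sub, conjTranspose_conjTranspose]
  rw [← neg_sub A, smul_neg, ← neg_smul]
  congr 1
  simp [neg_div]

lemma matRe_add_auxIm {n : ℕ} (A : Matrix (Fin n) (Fin n) ℂ) :
    matRe A + Complex.I • auxIm A = A := by
  unfold matRe auxIm
  rw [smul_smul]
  have : Complex.I * (-Complex.I / 2) = 2⁻¹ := by
    linear_combination (-1 / 2 : ℂ) * Complex.I_mul_I
  rw [this]; module

lemma matRe_sub_auxIm {n : ℕ} (A : Matrix (Fin n) (Fin n) ℂ) :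
    matRe A - Complex.I • auxIm A = Aᴴ := by
  unfold matRe auxIm
  rw [smul_smul]
  have : Complex.I * (-Complex.I / 2) = 2⁻¹ := by
    linear_combination (-1 / 2 : ℂ) * Complex.I_mul_I
  rw [this]; module

lemma aux_OT' {n : ℕ} {M : Matrix (Fin n) (Fin n) ℂ} (h : (matRe M).PosDef) :
    ‖(matRe M).det‖ ≤ ‖M.det‖ := by
  have := aux_OT h (auxIm_herm M)
  rwa [matRe_add_auxIm] at this

lemma aux_isUnit {n : ℕ} {M : Matrix (Fin n) (Fin n) ℂ} (h : (matRe M).PosDef) : IsUnit M := by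
  rw [isUnit_iff_isUnit_det, isUnit_iff_ne_zero, ← norm_pos_iff]
  exact lt_of_lt_of_le (norm_pos_iff.mpr h.det_pos.ne') (aux_OT' h)

lemma matRe_compress {n k : ℕ} (M : Matrix (Fin n) (Fin n) ℂ) (W : Matrix (Fin n) (Fin k) ℂ) :
    matRe (Wᴴ * M * W) = Wᴴ * matRe M * W := by
  unfold matRe
  simp only [conjTranspose_mul, conjTranspose_conjTranspose, Matrix.mul_add, Matrix.add_mul,
    Matrix.mul_smul, Matrix.smul_mul, Matrix.mul_assoc]

lemma matRe_add {n : ℕ} (M N : Matrix (Fin n) (Fin n) ℂ) :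
    matRe (M + N) = matRe M + matRe N := by
  unfold matRe; rw [conjTranspose_add]; module

lemma matRe_one {n : ℕ} : matRe (1 : Matrix (Fin n) (Fin n) ℂ) = 1 := by
  unfold matRe; rw [conjTranspose_one]; module

lemma star_form {n : ℕ} (A : Matrix (Fin n) (Fin n) ℂ) (x : Fin n → ℂ) :
    star x ⬝ᵥ Aᴴ *ᵥ x = star (star x ⬝ᵥ A *ᵥ x) := by
  rw [← star_dotProduct_star, star_mulVec, star_star, dotProduct_mulVec, dotProduct_comm]

lemma form_re {n : ℕ} (A : Matrix (Fin n) (Fin n) ℂ) (x : Fin n → ℂ) :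
    star x ⬝ᵥ matRe A *ᵥ x = ((star x ⬝ᵥ A *ᵥ x).re : ℂ) := by
  unfold matRe
  rw [smul_mulVec, dotProduct_smul, add_mulVec, dotProduct_add, star_form]
  apply Complex.ext <;> simp <;> ring

lemma form_im {n : ℕ} (A : Matrix (Fin n) (Fin n) ℂ) (x : Fin n → ℂ) :
    star x ⬝ᵥ auxIm A *ᵥ x = ((star x ⬝ᵥ A *ᵥ x).im : ℂ) := by
  unfold auxIm
  rw [smul_mulVec, dotProduct_smul, sub_mulVec, dotProduct_sub, star_form]
  apply Complex.ext <;> simp <;> ring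

lemma sector_all {n : ℕ} {α : ℝ} {A : Matrix (Fin n) (Fin n) ℂ} (hA : InSector α A)
    {x : Fin n → ℂ} (hx : x ≠ 0) : 0 < (star x ⬝ᵥ A *ᵥ x).re ∧
      |(star x ⬝ᵥ A *ᵥ x).im| ≤ Real.tan α * (star x ⬝ᵥ A *ᵥ x).re := by
  have h0 : 0 < star x ⬝ᵥ x := dotProduct_star_self_pos_iff.mpr hx
  obtain ⟨r, hr0, hr⟩ : ∃ r : ℝ, 0 < r ∧ star x ⬝ᵥ x = (r : ℂ) := by
    rw [Complex.pos_iff] at h0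
    exact ⟨_, h0.1, Complex.ext rfl (by simpa using h0.2.symm)⟩
  set c : ℝ := (Real.sqrt r)⁻¹ with hc
  have hcc : c * c = r⁻¹ := by rw [hc, ← mul_inv, Real.mul_self_sqrt hr0.le]
  have key : ∀ y : Fin n → ℂ, star ((c : ℂ) • x) ⬝ᵥ ((c : ℂ) • y) = ((r⁻¹ : ℝ) : ℂ) * (star x ⬝ᵥ y) := by
    intro y
    rw [star_smul, smul_dotProduct, dotProduct_smul, ← hcc]
    simp [mul_assoc]
  have := hA ((c : ℂ) • x) (by rw [key, hr, ← Complex.ofReal_mul, inv_mul_cancel₀ hr0.ne']; simp)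
  rw [mulVec_smul, key, Complex.re_ofReal_mul, Complex.im_ofReal_mul, abs_mul,
    abs_of_pos (inv_pos.mpr hr0)] at this
  have hri := inv_pos.mpr hr0
  refine ⟨pos_of_mul_pos_right this.1 hri.le, ?_⟩
  have h2 := this.2
  rw [mul_left_comm] at h2
  exact le_of_mul_le_mul_left h2 hri

lemma sector_posDef {n : ℕ} {α : ℝ} {A : Matrix (Fin n) (Fin n) ℂ} (hA : InSector α A) :
    (matRe A).PosDef := by
  apply PosDef.of_dotProduct_mulVec_pos (matRe_herm A)
  intro x hx
  rw [form_re]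
  exact_mod_cast (sector_all hA hx).1

lemma sector_pm {n : ℕ} {α : ℝ} {A : Matrix (Fin n) (Fin n) ℂ} (hA : InSector α A) :
    (((Real.tan α : ℝ) : ℂ) • matRe A + auxIm A).PosSemidef ∧
    (((Real.tan α : ℝ) : ℂ) • matRe A - auxIm A).PosSemidef := by
  have hH : (((Real.tan α : ℝ) : ℂ) • matRe A).IsHermitian := by
    rw [IsHermitian, conjTranspose_smul, (matRe_herm A).eq]
    congr 1
    exact Complex.conj_ofReal _
  constructor
  · apply PosSemidef.of_dotProduct_mulVec_nonneg (hH.add (auxIm_herm A))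
    intro x
    rw [add_mulVec, dotProduct_add, smul_mulVec, dotProduct_smul, form_re, form_im]
    by_cases hx : x = 0
    · simp [hx]
    have := abs_le.mp (sector_all hA hx).2
    rw [smul_eq_mul]
    exact_mod_cast (by linarith [this.1] :
      0 ≤ Real.tan α * (star x ⬝ᵥ A *ᵥ x).re + (star x ⬝ᵥ A *ᵥ x).im)
  · apply PosSemidef.of_dotProduct_mulVec_nonneg (hH.sub (auxIm_herm A))
    intro x
    rw [sub_mulVec, dotProduct_sub, smul_mulVec, dotProduct_smul, form_re, form_im]
    by_cases hx : x = 0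
    · simp [hx]
    have := abs_le.mp (sector_all hA hx).2
    rw [smul_eq_mul]
    exact_mod_cast (by linarith [this.2] :
      0 ≤ Real.tan α * (star x ⬝ᵥ A *ᵥ x).re - (star x ⬝ᵥ A *ᵥ x).im)

lemma aux_key0 {n k : ℕ} {t : ℝ} (ht : 0 ≤ t) {R K : Matrix (Fin n) (Fin n) ℂ}
    (hR : R.PosSemidef) (hp : ((t : ℂ) • R + K).PosSemidef) (hm : ((t : ℂ) • R - K).PosSemidef)
    (G Y : Matrix (Fin n) (Fin k) ℂ) :
    (Gᴴ * R * G + (t ^ 2 : ℂ) • (Yᴴ * R * Y)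
      - Complex.I • (Gᴴ * K * Y - Yᴴ * K * G)).PosSemidef := by
  have gen : ∀ s : ℝ, (((2 : ℂ) * t) • (Gᴴ * R * G + (s ^ 2 : ℂ) • (Yᴴ * R * Y))
      - ((2 : ℂ) * s * Complex.I) • (Gᴴ * K * Y - Yᴴ * K * G)).PosSemidef := by
    intro s
    have h1 := (hp.conjTranspose_mul_mul_same (G + (-Complex.I * s) • Y)).add
      (hm.conjTranspose_mul_mul_same (G - (-Complex.I * s) • Y))
    convert h1 using 1
    have hst : star (-Complex.I * (s : ℂ)) = Complex.I * s := by simp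
    simp only [conjTranspose_add, conjTranspose_sub, conjTranspose_smul, hst, Matrix.mul_add,
      Matrix.add_mul, Matrix.mul_sub, Matrix.sub_mul, Matrix.mul_smul, Matrix.smul_mul, smul_smul,
      smul_add, smul_sub]
    have hI := Complex.I_sq
    match_scalars <;> ring_nf <;> (try rw [hI]) <;> ring
  rcases ht.eq_or_lt with h0 | h0
  · have h1 := gen 1
    subst h0
    have h2 := (hR.conjTranspose_mul_mul_same G).add (h1.smul (a := (2⁻¹ : ℂ)) (by positivity))
    convert h2 using 1
    simp only [Complex.ofReal_zero, Complex.ofReal_one]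
    module
  · have h1 := (gen t).smul (a := ((2 * t)⁻¹ : ℂ)) (by
      have : (0 : ℝ) ≤ (2 * t)⁻¹ := by positivity
      exact_mod_cast this)
    convert h1 using 1
    have : (t : ℂ) ≠ 0 := by exact_mod_cast h0.ne'
    have e1 : ((2 : ℂ) * t)⁻¹ * (2 * t) = 1 := by field_simp
    have e2 : ((2 : ℂ) * t)⁻¹ * (2 * t * Complex.I) = Complex.I := by field_simp
    conv_rhs => rw [smul_sub, smul_smul, smul_smul, e1, e2, one_smul]

lemma aux_key1 {n k : ℕ} {t : ℝ} (ht : 0 ≤ t) {A : Matrix (Fin n) (Fin n) ℂ}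
    (hR : (matRe A).PosDef) (hp : ((t : ℂ) • matRe A + auxIm A).PosSemidef)
    (hm : ((t : ℂ) • matRe A - auxIm A).PosSemidef)
    {W : Matrix (Fin n) (Fin k) ℂ} (hW : Wᴴ * W = 1) (hA1 : (Wᴴ * matRe A * W).PosDef) :
    (((1 + t ^ 2 : ℂ)) • (Wᴴ * matRe A⁻¹ * W) - (Wᴴ * matRe A * W)⁻¹).PosSemidef := by
  have hAu : IsUnit A.det := (isUnit_iff_isUnit_det A).mp (aux_isUnit hR)
  set A1 := Wᴴ * matRe A * W with hA1d
  have hA1u : IsUnit A1.det := (isUnit_iff_isUnit_det A1).mp hA1.isUnit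
  have hA1H : (A1⁻¹)ᴴ = A1⁻¹ := hA1.inv.1
  set F := W * A1⁻¹ with hF
  set Y := A⁻¹ * W with hY
  have h := aux_key0 ht hR.posSemidef hp hm (F - Y) Y
  have hFR : Fᴴ * matRe A * F = A1⁻¹ := by
    calc Fᴴ * matRe A * F = A1⁻¹ * (Wᴴ * matRe A * W) * A1⁻¹ := by
          rw [hF, conjTranspose_mul, hA1H]; simp only [Matrix.mul_assoc]
      _ = A1⁻¹ := by rw [← hA1d, nonsing_inv_mul _ hA1u, Matrix.one_mul]
  have hAY : A * Y = W := by rw [hY, ← Matrix.mul_assoc, mul_nonsing_inv _ hAu, Matrix.one_mul]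
  have hFA : Fᴴ * (matRe A + Complex.I • auxIm A) * Y = A1⁻¹ := by
    rw [matRe_add_auxIm, Matrix.mul_assoc, hAY, hF, conjTranspose_mul, hA1H, Matrix.mul_assoc, hW,
      Matrix.mul_one]
  have hAF : Yᴴ * (matRe A - Complex.I • auxIm A) * F = A1⁻¹ := by
    rw [matRe_sub_auxIm, ← conjTranspose_mul, hAY, hF, ← Matrix.mul_assoc, hW, Matrix.one_mul]
  have hYY : Yᴴ * matRe A * Y = Wᴴ * matRe A⁻¹ * W := by
    have e1 : Yᴴ * A * Y = Wᴴ * (A⁻¹)ᴴ * W := by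
      rw [Matrix.mul_assoc, hAY, hY, conjTranspose_mul]
    have e2 : Yᴴ * Aᴴ * Y = Wᴴ * A⁻¹ * W := by
      rw [← conjTranspose_mul, hAY, hY, Matrix.mul_assoc]
    unfold matRe
    simp only [Matrix.mul_smul, Matrix.smul_mul, Matrix.mul_add, Matrix.add_mul, e1, e2]
    rw [add_comm]
  rw [← hYY]
  convert h using 1
  have hAA : A1⁻¹ = Fᴴ * (matRe A + Complex.I • auxIm A) * Y
    + Yᴴ * (matRe A - Complex.I • auxIm A) * F - Fᴴ * matRe A * F := by
    rw [hFA, hAF, hFR]; abel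
  rw [hAA]
  simp only [conjTranspose_sub, Matrix.mul_add, Matrix.add_mul, Matrix.mul_sub, Matrix.sub_mul,
    Matrix.mul_smul, Matrix.smul_mul, smul_sub, smul_add]
  module

lemma aux_side {n k : ℕ} (hk1 : 1 ≤ k) (hkn : k ≤ n) {α : ℝ} (hα : α ∈ Set.Ico 0 (Real.pi / 2))
    {A : Matrix (Fin n) (Fin n) ℂ} (hA : InSector α A)
    {W : Matrix (Fin n) (Fin k) ℂ} (hW : Wᴴ * W = 1) (hA1 : (Wᴴ * matRe A * W).PosDef) :
    ‖(1 + Wᴴ * matRe A * W).det‖ ≤ ‖(Wᴴ * matRe A * W).det‖ *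
      ((Real.cos α)⁻¹ ^ (2 * k) * ∏ j : Fin k, sval (1 + A⁻¹) (Fin.castLE hkn j)) := by
  have hR := sector_posDef hA
  have ht : 0 ≤ Real.tan α := Real.tan_nonneg_of_nonneg_of_le_pi_div_two hα.1 hα.2.le
  have hcos : 0 < Real.cos α := Real.cos_pos_of_mem_Ioo ⟨by linarith [hα.1, Real.pi_pos], hα.2⟩
  have hAu : IsUnit A.det := (isUnit_iff_isUnit_det A).mp (aux_isUnit hR)
  have hkey := aux_key1 ht hR (sector_pm hA).1 (sector_pm hA).2 hW hA1
  -- real part of the inverse is positive definite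
  have hRi : (matRe A⁻¹).PosSemidef := by
    have h := hR.posSemidef.conjTranspose_mul_mul_same A⁻¹
    convert h using 1
    have e0 : A * A⁻¹ = 1 := mul_nonsing_inv _ hAu
    have e1 : (A⁻¹)ᴴ * A * A⁻¹ = (A⁻¹)ᴴ := by rw [Matrix.mul_assoc, e0, Matrix.mul_one]
    have e2 : (A⁻¹)ᴴ * Aᴴ * A⁻¹ = A⁻¹ := by
      rw [← conjTranspose_mul, e0, conjTranspose_one, Matrix.one_mul]
    unfold matRe
    simp only [Matrix.mul_smul, Matrix.smul_mul, Matrix.mul_add, Matrix.add_mul, e1, e2]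
    rw [add_comm]
  have hD : (matRe (1 + A⁻¹)).PosDef := by
    rw [matRe_add, matRe_one]
    exact PosDef.one.add_posSemidef hRi
  have hWD : matRe (Wᴴ * (1 + A⁻¹) * W) = 1 + Wᴴ * matRe A⁻¹ * W := by
    rw [matRe_compress, matRe_add, matRe_one, Matrix.mul_add, Matrix.add_mul, Matrix.mul_one, hW]
  have hWDp : (matRe (Wᴴ * (1 + A⁻¹) * W)).PosDef := by
    rw [hWD]
    exact PosDef.one.add_posSemidef (hRi.conjTranspose_mul_mul_same W)
  set A1 := Wᴴ * matRe A * W with hA1d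
  have hA1u : IsUnit A1.det := (isUnit_iff_isUnit_det A1).mp hA1.isUnit
  have h1 : ‖(1 + A1⁻¹).det‖ ≤
      ‖((1 + (Real.tan α : ℂ) ^ 2) • matRe (Wᴴ * (1 + A⁻¹) * W)).det‖ := by
    apply aux_det_mono (PosSemidef.one.add hA1.inv.posSemidef)
    have h2 : (((Real.tan α : ℂ) ^ 2) • (1 : Matrix (Fin k) (Fin k) ℂ)).PosSemidef := by
      apply PosSemidef.one.smul
      have : 0 ≤ Real.tan α ^ 2 := sq_nonneg _
      exact_mod_cast this
    convert h2.add hkey using 1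
    rw [hWD]
    module
  have hsec : ‖(1 + (Real.tan α : ℂ) ^ 2)‖ = (Real.cos α)⁻¹ ^ 2 := by
    have : (1 + (Real.tan α : ℂ) ^ 2) = ((1 + Real.tan α ^ 2 : ℝ) : ℂ) := by push_cast; rfl
    rw [this, Complex.norm_real, Real.norm_eq_abs, abs_of_nonneg (by positivity), inv_pow,
      ← Real.inv_one_add_tan_sq hcos.ne', inv_inv]
  have h3 : ‖(1 + A1⁻¹).det‖ ≤
      (Real.cos α)⁻¹ ^ (2 * k) * ∏ j : Fin k, sval (1 + A⁻¹) (Fin.castLE hkn j) := by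
    refine h1.trans ?_
    rw [det_smul, norm_mul, norm_pow, hsec, Fintype.card_fin, ← pow_mul]
    gcongr
    exact (aux_OT' hWDp).trans (aux_sval_upper hk1 hkn (aux_isUnit hD) hW)
  have h4 : 1 + A1 = A1 * (1 + A1⁻¹) := by
    rw [Matrix.mul_add, mul_nonsing_inv _ hA1u, Matrix.mul_one, add_comm]
  rw [h4, det_mul, norm_mul]
  gcongr

lemma aux_arith {s sa sb a b c q q' u v : ℝ} {k : ℕ} (hs : 0 ≤ s) (hsa : 0 ≤ sa)
    (ha : 0 < a) (hb : 0 < b) (hc : 0 < c) (hu : 0 ≤ u) (hv : 0 ≤ v)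
    (hWS : q' * s ≤ 1) (hOT : q ≤ q') (hmain : 4 ^ k * (a * b) ≤ q * (u * v))
    (hsA : u ≤ a * (c ^ (2 * k) * sa)) (hsB : v ≤ b * (c ^ (2 * k) * sb)) :
    s ≤ c ^ (4 * k) / 4 ^ k * (sa * sb) := by
  rw [div_mul_eq_mul_div, le_div_iff₀ (by positivity)]
  apply le_of_mul_le_mul_left _ (mul_pos ha hb)
  have hq : q * s ≤ 1 := (mul_le_mul_of_nonneg_right hOT hs).trans hWS
  calc a * b * (s * 4 ^ k) = (4 ^ k * (a * b)) * s := by ring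
    _ ≤ (q * (u * v)) * s := by gcongr
    _ = (q * s) * (u * v) := by ring
    _ ≤ 1 * (u * v) := mul_le_mul_of_nonneg_right hq (mul_nonneg hu hv)
    _ ≤ 1 * ((a * (c ^ (2 * k) * sa)) * (b * (c ^ (2 * k) * sb))) := by gcongr
    _ = a * b * (c ^ (4 * k) * (sa * sb)) := by
        rw [show 4 * k = 2 * k + 2 * k by ring, pow_add]; ring

/-- For sector matrices `A, B` of angle `α ∈ [0, π/2)` and `1 ≤ k ≤ n`,
`∏_{j=1}^k s_j((A+B)⁻¹) ≤ (sec^{4k}(α)/4^k) ∏_{j=1}^k s_j(I + A⁻¹) ∏_{j=1}^k s_j(I + B⁻¹)`. -/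
theorem stmt2 {n : ℕ} {α : ℝ} (hα : α ∈ Set.Ico 0 (Real.pi / 2))
    {A B : Matrix (Fin n) (Fin n) ℂ} (hA : InSector α A) (hB : InSector α B)
    {k : ℕ} (hk1 : 1 ≤ k) (hkn : k ≤ n) :
    ∏ j ∈ Finset.univ.filter (fun j : Fin n => (j : ℕ) < k), sval (A + B)⁻¹ j ≤
      ((Real.cos α)⁻¹ ^ (4 * k) / 4 ^ k) *
        ((∏ j ∈ Finset.univ.filter (fun j : Fin n => (j : ℕ) < k), sval (1 + A⁻¹) j) *
          ∏ j ∈ Finset.univ.filter (fun j : Fin n => (j : ℕ) < k), sval (1 + B⁻¹) j) := by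
  have hRA := sector_posDef hA
  have hRB := sector_posDef hB
  have hcos : 0 < Real.cos α := Real.cos_pos_of_mem_Ioo ⟨by linarith [hα.1, Real.pi_pos], hα.2⟩
  have hS : (matRe (A + B)).PosDef := by rw [matRe_add]; exact hRA.add hRB
  have hSu : IsUnit (A + B).det := (isUnit_iff_isUnit_det _).mp (aux_isUnit hS)
  rw [aux_prod_eq hkn, aux_prod_eq hkn, aux_prod_eq hkn]
  obtain ⟨W, hW, hWS⟩ := aux_sval_inv hkn (mul_nonsing_inv _ hSu)
  have hinj : Function.Injective W.mulVec := by
    intro x y hxy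
    have := congrArg (fun z => Wᴴ *ᵥ z) hxy
    simpa [mulVec_mulVec, hW] using this
  have hA1 : (Wᴴ * matRe A * W).PosDef := hRA.conjTranspose_mul_mul_same hinj
  have hB1 : (Wᴴ * matRe B * W).PosDef := hRB.conjTranspose_mul_mul_same hinj
  have hsum : matRe (Wᴴ * (A + B) * W) = Wᴴ * matRe A * W + Wᴴ * matRe B * W := by
    rw [matRe_compress, matRe_add, Matrix.mul_add, Matrix.add_mul]
  have hOT := aux_OT' (M := Wᴴ * (A + B) * W) (by rw [hsum]; exact hA1.add hB1)
  rw [hsum] at hOT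
  have hmain := aux_main_det hA1.posSemidef hB1.posSemidef
  rw [Fintype.card_fin] at hmain
  have hsA := aux_side hk1 hkn hα hA hW hA1
  have hsB := aux_side hk1 hkn hα hB hW hB1
  have hpA : 0 < ‖(Wᴴ * matRe A * W).det‖ := norm_pos_iff.mpr hA1.det_pos.ne'
  have hpB : 0 < ‖(Wᴴ * matRe B * W).det‖ := norm_pos_iff.mpr hB1.det_pos.ne'
  have hsn : ∀ (X : Matrix (Fin n) (Fin n) ℂ) j, 0 ≤ sval X j := fun X j => Real.sqrt_nonneg _
  exact aux_arith (Finset.prod_nonneg fun j _ => hsn _ _) (Finset.prod_nonneg fun j _ => hsn _ _)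
    hpA hpB (inv_pos.mpr hcos) (norm_nonneg _) (norm_nonneg _) hWS hOT hmain hsA hsB
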